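/- Let N ≥ 5, let u ∈ D^{2,2}_r(ℝ^N), and let ũ : (0,∞) → ℝ be such that u(x) = ũ(|x|) for almost every x ∈ ℝ^N. Then ũ ∈ W^{2,1}(I) for every open bounded interval I ⊂ (0,∞) with inf I > 0, i.e. ũ and its weak derivatives up to order two are integrable on I. -/

import Mathlib

open MeasureTheory Filter Topology Set ENNReal

noncomputable section

/-- Euclidean space `ℝ^N`. -/
abbrev E (N : ℕ) := EuclideanSpace ℝ (Fin N)

/-- The (classical) Laplacian of a function `φ : ℝ^N → ℝ`. -/
def lapl {N : ℕ} (φ : E N → ℝ) (x : E N) : ℝ :=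
  ∑ i : Fin N, fderiv ℝ (fun y => fderiv ℝ φ y (EuclideanSpace.single i 1)) x
    (EuclideanSpace.single i 1)

/-- A function is radial if it depends only on the norm. -/
def IsRadial {N : ℕ} (u : E N → ℝ) : Prop := ∀ x y : E N, ‖x‖ = ‖y‖ → u x = u y

/-- The critical exponent `2** = 2N/(N-4)` as an element of `ℝ≥0∞`. -/
def twoSS (N : ℕ) : ℝ≥0∞ := (2 * N : ℝ≥0∞) / ((N : ℝ≥0∞) - 4)

/-- `u ∈ D^{2,2}(ℝ^N)` with (distributional) Laplacian `w`: `u` lies in `L^{2**}`,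
`w ∈ L²`, and `u` is the limit in `L^{2**}` of smooth compactly supported functions whose
Laplacians converge to `w` in `L²` (i.e. `u` lies in the closure of `C_c^∞` for the norm
`‖Δ·‖_{L²}`, with `Δu = w`). -/
def MemD22 (N : ℕ) (u w : E N → ℝ) : Prop :=
  MemLp u (twoSS N) volume ∧ MemLp w 2 volume ∧
  ∃ φ : ℕ → E N → ℝ,
    (∀ n, ContDiff ℝ (⊤ : ℕ∞) (φ n) ∧ HasCompactSupport (φ n)) ∧
    Tendsto (fun n => eLpNorm (fun x => φ n x - u x) (twoSS N) volume) atTop (𝓝 0) ∧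
    Tendsto (fun n => eLpNorm (fun x => lapl (φ n) x - w x) 2 volume) atTop (𝓝 0)

/-- `u ∈ H²_V(ℝ^N)` (with Laplacian `w`). -/
def MemH2V {N : ℕ} (V : ℝ → ℝ≥0∞) (u w : E N → ℝ) : Prop :=
  MemD22 N u w ∧ (∫⁻ x : E N, V ‖x‖ * ENNReal.ofReal ((u x) ^ 2)) < ⊤

/-- `u ∈ H²_{V,r}(ℝ^N)`: member of `H²_V` which is radial. -/
def MemH2Vr {N : ℕ} (V : ℝ → ℝ≥0∞) (u w : E N → ℝ) : Prop :=
  MemH2V V u w ∧ IsRadial u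

/-- The norm of `H²_V`: `‖u‖ = (∫ |Δu|² + V(|x|)u²)^{1/2}` (here `w = Δu`). -/
def H2norm {N : ℕ} (V : ℝ → ℝ≥0∞) (u w : E N → ℝ) : ℝ :=
  (((∫⁻ x : E N, ENNReal.ofReal ((w x) ^ 2)) +
    ∫⁻ x : E N, V ‖x‖ * ENNReal.ofReal ((u x) ^ 2)).toReal) ^ (1/2 : ℝ)

/-- Hypothesis (V): `V : (0,∞) → [0,∞]` measurable and locally integrable on `(0,∞)`. -/
def HypV (V : ℝ → ℝ≥0∞) : Prop :=
  Measurable V ∧ ∀ a b : ℝ, 0 < a → (∫⁻ r in Set.Icc a b, V r) < ⊤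

/-- Hypothesis (K): `K : (0,∞) → (0,∞)` measurable with `K ∈ L^s_loc((0,∞))`. -/
def HypK (K : ℝ → ℝ) (s : ℝ) : Prop :=
  (∀ r : ℝ, 0 < r → 0 < K r) ∧ Measurable K ∧ 1 < s ∧
  ∀ a b : ℝ, 0 < a → IntegrableOn (fun r => K r ^ s) (Set.Icc a b) volume

/-- The quantity `S₀(q,R)`. -/
def S0 (N : ℕ) (V : ℝ → ℝ≥0∞) (K : ℝ → ℝ) (q R : ℝ) : ℝ≥0∞ :=
  ⨆ p : {p : (E N → ℝ) × (E N → ℝ) // MemH2Vr V p.1 p.2 ∧ H2norm V p.1 p.2 = 1},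
    ∫⁻ x in Metric.ball (0 : E N) R, ENNReal.ofReal (K ‖x‖ * |p.1.1 x| ^ q)

/-- The quantity `S_∞(q,R)`. -/
def Sinf (N : ℕ) (V : ℝ → ℝ≥0∞) (K : ℝ → ℝ) (q R : ℝ) : ℝ≥0∞ :=
  ⨆ p : {p : (E N → ℝ) × (E N → ℝ) // MemH2Vr V p.1 p.2 ∧ H2norm V p.1 p.2 = 1},
    ∫⁻ x in (Metric.ball (0 : E N) R)ᶜ, ENNReal.ofReal (K ‖x‖ * |p.1.1 x| ^ q)

/-- The quantity `R₀(q,R)`. -/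
def R0 (N : ℕ) (V : ℝ → ℝ≥0∞) (K : ℝ → ℝ) (q R : ℝ) : ℝ≥0∞ :=
  ⨆ p : {p : ((E N → ℝ) × (E N → ℝ)) × ((E N → ℝ) × (E N → ℝ)) //
      MemH2Vr V p.1.1 p.1.2 ∧ MemH2Vr V p.2.1 p.2.2 ∧
      H2norm V p.1.1 p.1.2 = 1 ∧ H2norm V p.2.1 p.2.2 = 1},
    ∫⁻ x in Metric.ball (0 : E N) R,
      ENNReal.ofReal (K ‖x‖ * |p.1.1.1 x| ^ (q - 1) * |p.1.2.1 x|)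

/-- The quantity `R_∞(q,R)`. -/
def Rinf (N : ℕ) (V : ℝ → ℝ≥0∞) (K : ℝ → ℝ) (q R : ℝ) : ℝ≥0∞ :=
  ⨆ p : {p : ((E N → ℝ) × (E N → ℝ)) × ((E N → ℝ) × (E N → ℝ)) //
      MemH2Vr V p.1.1 p.1.2 ∧ MemH2Vr V p.2.1 p.2.2 ∧
      H2norm V p.1.1 p.1.2 = 1 ∧ H2norm V p.2.1 p.2.2 = 1},
    ∫⁻ x in (Metric.ball (0 : E N) R)ᶜ,
      ENNReal.ofReal (K ‖x‖ * |p.1.1.1 x| ^ (q - 1) * |p.1.2.1 x|)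

/-- The weighted measure `K(|x|)dx`. -/
def Kmeas (N : ℕ) (K : ℝ → ℝ) : Measure (E N) :=
  volume.withDensity (fun x => ENNReal.ofReal (K ‖x‖))

/-- Membership in the sum space `L^{q₁}_K + L^{q₂}_K`. -/
def MemSum (N : ℕ) (K : ℝ → ℝ) (q1 q2 : ℝ) (u : E N → ℝ) : Prop :=
  ∃ u1 u2 : E N → ℝ, u = u1 + u2 ∧ MemLp u1 (ENNReal.ofReal q1) (Kmeas N K) ∧
    MemLp u2 (ENNReal.ofReal q2) (Kmeas N K)

/-- The norm of the sum space `L^{q₁}_K + L^{q₂}_K`. -/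
def sumNorm (N : ℕ) (K : ℝ → ℝ) (q1 q2 : ℝ) (u : E N → ℝ) : ℝ≥0∞ :=
  ⨅ p : {p : (E N → ℝ) × (E N → ℝ) // u = p.1 + p.2},
    max (eLpNorm p.1.1 (ENNReal.ofReal q1) (Kmeas N K))
        (eLpNorm p.1.2 (ENNReal.ofReal q2) (Kmeas N K))

/-- `σ_N`, the (N-1)-dimensional measure of the unit sphere, i.e. `N·ω_N`. -/
def sigmaN (N : ℕ) : ℝ := N * (volume (Metric.ball (0 : E N) 1)).toReal

end


/-- test functions on `(a,b)` -/
def Tst (a b : ℝ) (φ : ℝ → ℝ) : Prop :=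
  ContDiff ℝ (⊤ : ℕ∞) φ ∧ HasCompactSupport φ ∧ tsupport φ ⊆ Set.Ioo a b

lemma Tst.zero_of {a b : ℝ} {φ : ℝ → ℝ} (h : Tst a b φ) {x : ℝ} (hx : x ∉ Set.Ioo a b) : φ x = 0 :=
  image_eq_zero_of_notMem_tsupport fun h' => hx (h.2.2 h')

lemma Tst.deriv {a b : ℝ} {φ : ℝ → ℝ} (h : Tst a b φ) : Tst a b (deriv φ) := by
  refine ⟨?_, h.2.1.deriv, (tsupport_deriv_subset).trans h.2.2⟩
  have := h.1
  exact (contDiff_infty_iff_deriv.1 this).2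

lemma Tst.mul {a b : ℝ} (ha : 0 < a) {φ p : ℝ → ℝ} (h : Tst a b φ)
    (hp : ∀ x, 0 < x → ContDiffAt ℝ (⊤ : ℕ∞) p x) : Tst a b (fun x => p x * φ x) := by
  have hsub : tsupport (fun x => p x * φ x) ⊆ tsupport φ := tsupport_mul_subset_right
  refine ⟨?_, h.2.1.mul_left, hsub.trans h.2.2⟩
  rw [contDiff_iff_contDiffAt]
  intro x
  by_cases hx : x ∈ tsupport φ
  · exact (hp x (ha.trans (h.2.2 hx).1)).mul h.1.contDiffAt
  · have : (fun x => p x * φ x) =ᶠ[𝓝 x] fun _ => 0 := by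
      filter_upwards [notMem_tsupport_iff_eventuallyEq.1 hx] with y hy
      simp [hy]
    exact contDiffAt_const.congr_of_eventuallyEq this

lemma Tst.add_smul {a b : ℝ} {φ ψ : ℝ → ℝ} (h : Tst a b φ) (h' : Tst a b ψ) (c : ℝ) :
    Tst a b (fun x => φ x - c * ψ x) := by
  refine ⟨h.1.sub (contDiff_const.mul h'.1), ?_, ?_⟩
  · exact h.2.1.sub (h'.2.1.mul_left)
  · refine (tsupport_sub φ (fun x => c * ψ x)).trans (union_subset h.2.2 ?_)
    exact tsupport_mul_subset_right.trans h'.2.2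

lemma Tst.prim {a b : ℝ} (hab : a < b) {η : ℝ → ℝ} (h : Tst a b η)
    (h0 : ∫ t in Set.Ioo a b, η t = 0) : ∃ ψ, Tst a b ψ ∧ _root_.deriv ψ = η := by
  have hηc : Continuous η := h.1.continuous
  set ψ : ℝ → ℝ := fun t => ∫ s in a..t, η s with hψ
  have hd : ∀ t, HasDerivAt ψ (η t) t := fun t =>
    intervalIntegral.integral_hasDerivAt_right (hηc.intervalIntegrable _ _)
      (hηc.stronglyMeasurableAtFilter _ _) hηc.continuousAt
  have hdd : _root_.deriv ψ = η := funext fun t => (hd t).deriv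
  obtain ⟨c, d, hcd, hsub⟩ : ∃ c d : ℝ, Set.Icc c d ⊆ Set.Ioo a b ∧ tsupport η ⊆ Set.Icc c d := by
    by_cases hne : (tsupport η).Nonempty
    · obtain ⟨c, hc, hc'⟩ := h.2.1.isCompact.exists_isLeast hne
      obtain ⟨d, hd, hd'⟩ := h.2.1.isCompact.exists_isGreatest hne
      exact ⟨c, d, fun x hx => ⟨(h.2.2 hc).1.trans_le hx.1, hx.2.trans_lt (h.2.2 hd).2⟩,
        fun x hx => ⟨hc' hx, hd' hx⟩⟩
    · rw [not_nonempty_iff_eq_empty] at hne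
      exact ⟨1, 0, by simp, by simp [hne]⟩
  have hz : ∀ x, x ∉ Set.Icc c d → η x = 0 := fun x hx =>
    image_eq_zero_of_notMem_tsupport fun h' => hx (hsub h')
  have hψs : Function.support ψ ⊆ Set.Icc c d := by
    intro t ht
    by_contra hn
    apply ht
    rw [mem_Icc, not_and_or, not_le, not_le] at hn
    rcases hn with hn | hn
    · have : ∀ s ∈ Set.uIcc a t, η s = 0 := by
        intro s hs
        by_cases hs' : s ∈ Set.Icc c d
        · exfalso
          have := (hcd hs').1
          rcases le_total a t with hh | hh
          · rw [uIcc_of_le hh] at hs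
            linarith [hs.2, hs'.1]
          · rw [uIcc_of_ge hh] at hs
            linarith [hs.2]
        · exact hz s hs'
      simp only [hψ]
      rw [intervalIntegral.integral_congr (g := fun _ => 0) this]
      simp
    · have h1 : ∫ s in a..b, η s = 0 := by
        rw [intervalIntegral.integral_of_le hab.le, integral_Ioc_eq_integral_Ioo, h0]
      have : ∀ s ∈ Set.uIcc b t, η s = 0 := by
        intro s hs
        by_cases hs' : s ∈ Set.Icc c d
        · exfalso
          have := (hcd hs').2
          rcases le_total b t with hh | hh
          · rw [uIcc_of_le hh] at hs
            linarith [hs.1, hs'.1]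
          · rw [uIcc_of_ge hh] at hs
            linarith [hs.1, hs'.2]
        · exact hz s hs'
      simp only [hψ]
      rw [← intervalIntegral.integral_add_adjacent_intervals (b := b)
        (hηc.intervalIntegrable _ _) (hηc.intervalIntegrable _ _), h1,
        intervalIntegral.integral_congr (g := fun _ => 0) this]
      simp
  have hts : tsupport ψ ⊆ Set.Icc c d := closure_minimal hψs isClosed_Icc
  refine ⟨ψ, ⟨?_, ?_, hts.trans hcd⟩, hdd⟩
  · refine contDiff_infty_iff_deriv.2 ⟨fun t => (hd t).differentiableAt, ?_⟩
    rw [hdd]; exact h.1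
  · exact HasCompactSupport.of_support_subset_isCompact isCompact_Icc hψs

lemma exists_Tst {a b : ℝ} (hab : a < b) : ∃ η, Tst a b η ∧ ∫ t in Set.Ioo a b, η t = 1 := by
  let f : ContDiffBump ((a + b) / 2) := ⟨(b - a) / 8, (b - a) / 4, by linarith, by linarith⟩
  have hs : tsupport (f.normed volume) ⊆ Set.Ioo a b := by
    rw [f.tsupport_normed_eq, Real.closedBall_eq_Icc]
    intro x hx
    have h1 := hx.1
    have h2 := hx.2
    simp only [f] at h1 h2
    constructor <;> linarith
  have hT : Tst a b (f.normed volume) := ⟨f.contDiff_normed, f.hasCompactSupport_normed, hs⟩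
  refine ⟨f.normed volume, hT, ?_⟩
  rw [setIntegral_eq_integral_of_forall_compl_eq_zero (fun x hx => hT.zero_of hx)]
  exact f.integral_normed

lemma ibp {a b : ℝ} (hab : a < b) {f : ℝ → ℝ} (hf : IntegrableOn f (Set.Ioo a b))
    {χ : ℝ → ℝ} (h : Tst a b χ) :
    ∫ t in Set.Ioo a b, (∫ s in a..t, f s) * deriv χ t = - ∫ t in Set.Ioo a b, f t * χ t := by
  have hfi : IntervalIntegrable f volume a b := by
    rw [intervalIntegrable_iff_integrableOn_Ioo_of_le hab.le]; exact hf
  have h1 := hfi.absolutelyContinuousOnInterval_intervalIntegral (c := a) (by simp)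
  have h2 : AbsolutelyContinuousOnInterval χ a b :=
    ContDiffOn.absolutelyContinuousOnInterval ((h.1.of_le (by simp)).contDiffOn)
  have h3 := h1.integral_mul_deriv_eq_deriv_mul h2
  rw [h.zero_of (x := a) (by simp), h.zero_of (x := b) (by simp)] at h3
  simp only [intervalIntegral.integral_of_le hab.le, integral_Ioc_eq_integral_Ioo] at h3 ⊢
  simp only [← integral_Ioc_eq_integral_Ioo] at h3
  simp only [integral_Ioc_eq_integral_Ioo] at h3
  rw [mul_zero, mul_zero, sub_zero, zero_sub] at h3
  have h4 : ∫ x in Set.Ioo a b, deriv (fun x => ∫ v in a..x, f v) x * χ x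
      = ∫ x in Set.Ioo a b, f x * χ x := by
    apply setIntegral_congr_ae measurableSet_Ioo
    filter_upwards [hfi.ae_hasDerivAt_integral] with x hx hx'
    rw [(hx (by rw [uIcc_of_le hab.le]; exact Ioo_subset_Icc_self hx') a (by simp)).deriv]
  rw [← h4, ← h3]

lemma integrableOn_mul_cont {a b : ℝ} {f g : ℝ → ℝ} (hf : IntegrableOn f (Set.Ioo a b))
    (hg : ContinuousOn g (Set.Icc a b)) : IntegrableOn (fun x => f x * g x) (Set.Ioo a b) := by
  rw [← integrableOn_Icc_iff_integrableOn_Ioo] at hf ⊢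
  exact hf.mul_continuousOn hg isCompact_Icc

lemma oneD {a b : ℝ} (ha : 0 < a) (hab : a < b) (n : ℕ) {U f : ℝ → ℝ}
    (hU : IntegrableOn U (Set.Ioo a b)) (hf : IntegrableOn f (Set.Ioo a b))
    (H : ∀ ψ, Tst a b ψ → ∫ t in Set.Ioo a b, U t * deriv (fun r => r ^ n * deriv ψ r) t
      = ∫ t in Set.Ioo a b, f t * ψ t) :
    ∃ g h : ℝ → ℝ,
        IntegrableOn g (Set.Ioo a b) volume ∧ IntegrableOn h (Set.Ioo a b) volume ∧
        (∀ φ : ℝ → ℝ, Tst a b φ →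
          ∫ t in Set.Ioo a b, U t * deriv φ t = - ∫ t in Set.Ioo a b, g t * φ t) ∧
        (∀ φ : ℝ → ℝ, Tst a b φ →
          ∫ t in Set.Ioo a b, g t * deriv φ t = - ∫ t in Set.Ioo a b, h t * φ t) := by
  set F : ℝ → ℝ := fun t => ∫ s in a..t, f s with hF
  have hfi : IntervalIntegrable f volume a b := by
    rw [intervalIntegrable_iff_integrableOn_Ioo_of_le hab.le]; exact hf
  have hFc : ContinuousOn F (Set.Icc a b) := by
    have := (hfi.absolutelyContinuousOnInterval_intervalIntegral (c := a) (by simp)).continuousOn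
    rwa [uIcc_of_le hab.le] at this
  have hFi : IntegrableOn F (Set.Ioo a b) :=
    (hFc.integrableOn_compact isCompact_Icc).mono_set Ioo_subset_Icc_self
  have hpow : ∀ x : ℝ, 0 < x → ContDiffAt ℝ (⊤ : ℕ∞) (fun r : ℝ => r ^ n) x := fun x _ =>
    (contDiff_id.pow n).contDiffAt
  have hinv : ∀ x : ℝ, 0 < x → ContDiffAt ℝ (⊤ : ℕ∞) (fun r : ℝ => (r ^ n)⁻¹) x := fun x hx =>
    (hpow x hx).inv (by positivity)
  have ic : ∀ {v η : ℝ → ℝ}, IntegrableOn v (Set.Ioo a b) → Continuous η →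
      IntegrableOn (fun t => v t * η t) (Set.Ioo a b) := fun hv hη =>
    integrableOn_mul_cont hv hη.continuousOn
  -- step 1
  have H1 : ∀ η, Tst a b η → ∫ t in Set.Ioo a b, η t = 0 →
      ∫ t in Set.Ioo a b, U t * deriv (fun r => r ^ n * η r) t
        = - ∫ t in Set.Ioo a b, F t * η t := by
    intro η hη h0
    obtain ⟨ψ, hψ, hd⟩ := hη.prim hab h0
    have := H ψ hψ
    have h2 := ibp hab hf hψ
    rw [hd] at this h2
    rw [this, h2, neg_neg]
  obtain ⟨η₀, hη₀, hInt1⟩ := exists_Tst hab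
  set c : ℝ := (∫ t in Set.Ioo a b, U t * deriv (fun r => r ^ n * η₀ r) t)
        + ∫ t in Set.Ioo a b, F t * η₀ t with hc
  have H2 : ∀ η, Tst a b η →
      ∫ t in Set.Ioo a b, U t * deriv (fun r => r ^ n * η r) t
        = - ∫ t in Set.Ioo a b, (F t - c) * η t := by
    intro η hη
    set m := ∫ t in Set.Ioo a b, η t with hm
    have hηi : IntegrableOn η (Set.Ioo a b) :=
      (hη.1.continuous.integrable_of_hasCompactSupport hη.2.1).integrableOn
    have hη₀i : IntegrableOn η₀ (Set.Ioo a b) :=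
      (hη₀.1.continuous.integrable_of_hasCompactSupport hη₀.2.1).integrableOn
    have hT := hη.add_smul hη₀ m
    have h0 : ∫ t in Set.Ioo a b, (η t - m * η₀ t) = 0 := by
      rw [integral_sub hηi (hη₀i.const_mul m), integral_const_mul, hInt1, ← hm]; ring
    have h1 := H1 _ hT h0
    have T1 := (hη.mul ha hpow)
    have T0 := (hη₀.mul ha hpow)
    have e1 : ∀ t, deriv (fun r => r ^ n * (η r - m * η₀ r)) t
        = deriv (fun r => r ^ n * η r) t - m * deriv (fun r => r ^ n * η₀ r) t := by
      intro t
      have d1 := (T1.1.differentiable (by simp)) t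
      have d0 := (T0.1.differentiable (by simp)) t
      have : (fun r => r ^ n * (η r - m * η₀ r)) =
        (fun r => r ^ n * η r - m * (r ^ n * η₀ r)) := by ext; ring
      rw [this]
      exact (d1.hasDerivAt.sub (d0.hasDerivAt.const_mul m)).deriv
    have e2 : ∫ t in Set.Ioo a b, U t * deriv (fun r => r ^ n * (η r - m * η₀ r)) t
        = (∫ t in Set.Ioo a b, U t * deriv (fun r => r ^ n * η r) t)
          - m * ∫ t in Set.Ioo a b, U t * deriv (fun r => r ^ n * η₀ r) t := by
      rw [← integral_const_mul, ← integral_sub (ic hU T1.deriv.1.continuous)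
        ((ic hU T0.deriv.1.continuous).const_mul m)]
      congr 1; ext t; rw [e1]; ring
    have e3 : ∫ t in Set.Ioo a b, F t * (η t - m * η₀ t)
        = (∫ t in Set.Ioo a b, F t * η t) - m * ∫ t in Set.Ioo a b, F t * η₀ t := by
      rw [← integral_const_mul, ← integral_sub (ic hFi hη.1.continuous)
        ((ic hFi hη₀.1.continuous).const_mul m)]
      congr 1; ext t; ring
    have e4 : ∫ t in Set.Ioo a b, (F t - c) * η t = (∫ t in Set.Ioo a b, F t * η t) - c * m := by
      rw [hm, ← integral_const_mul, ← integral_sub (ic hFi hη.1.continuous) (hηi.const_mul c)]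
      congr 1; ext t; ring
    rw [e2, e3] at h1
    rw [e4]
    linear_combination h1 + m * hc
  have hne : ∀ x ∈ Set.Icc a b, x ^ n ≠ 0 := fun x hx => (pow_pos (ha.trans_le hx.1) n).ne'
  have hne' : ∀ x ∈ Set.Icc a b, x ^ (n+1) ≠ 0 :=
    fun x hx => (pow_pos (ha.trans_le hx.1) (n+1)).ne'
  have hic : ContinuousOn (fun x : ℝ => (x ^ n)⁻¹) (Set.Icc a b) :=
    (continuous_pow n).continuousOn.inv₀ hne
  have hic' : ContinuousOn (fun x : ℝ => n * (x ^ (n+1))⁻¹) (Set.Icc a b) :=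
    continuousOn_const.mul ((continuous_pow (n+1)).continuousOn.inv₀ hne')
  have hFci : IntegrableOn (fun t => F t - c) (Set.Ioo a b) :=
    hFi.sub (continuous_const.integrableOn_Icc.mono_set Ioo_subset_Icc_self)
  have i1 : IntegrableOn (fun t => (F t - c) * (t ^ n)⁻¹) (Set.Ioo a b) :=
    integrableOn_mul_cont hFci hic
  have i2 : IntegrableOn (fun t => (F t - c) * (n * (t ^ (n+1))⁻¹)) (Set.Ioo a b) :=
    integrableOn_mul_cont hFci hic'
  have i3 : IntegrableOn (fun t => f t * (t ^ n)⁻¹) (Set.Ioo a b) :=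
    integrableOn_mul_cont hf hic
  have i4 : IntegrableOn (fun t => f t * (t ^ n)⁻¹ - (F t - c) * (n * (t ^ (n+1))⁻¹))
      (Set.Ioo a b) := i3.sub i2
  refine ⟨fun t => (F t - c) * (t ^ n)⁻¹,
    fun t => f t * (t ^ n)⁻¹ - (F t - c) * (n * (t ^ (n+1))⁻¹), i1, i4, ?_, ?_⟩
  · intro φ hφ
    have := H2 _ (hφ.mul ha hinv)
    have e : (fun r : ℝ => r ^ n * ((r ^ n)⁻¹ * φ r)) = φ := by
      ext r
      by_cases hr : r ∈ Set.Ioo a b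
      · rw [mul_inv_cancel_left₀ (hne r (Ioo_subset_Icc_self hr))]
      · simp [hφ.zero_of hr]
    rw [e] at this
    rw [this]
    congr 2; ext t; ring
  · intro φ hφ
    set χ : ℝ → ℝ := fun r => (r ^ n)⁻¹ * φ r with hχ
    have hT : Tst a b χ := hφ.mul ha hinv
    have h1 := ibp hab hf hT
    have h2 : ∫ t in Set.Ioo a b, deriv χ t = 0 := by
      have := ibp hab (f := fun _ => 0) (by simp) hT.deriv
      have h3 := intervalIntegral.integral_deriv_eq_sub (f := χ) (a := a) (b := b)
        (fun x _ => (hT.1.differentiable (by simp)) x)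
        (hT.deriv.1.continuous.intervalIntegrable _ _)
      rw [hT.zero_of (x := a) (by simp), hT.zero_of (x := b) (by simp),
        intervalIntegral.integral_of_le hab.le, integral_Ioc_eq_integral_Ioo] at h3
      simpa using h3
    have hdi : IntegrableOn (deriv χ) (Set.Ioo a b) :=
      (hT.deriv.1.continuous.integrable_of_hasCompactSupport hT.deriv.2.1).integrableOn
    have h3 : ∫ t in Set.Ioo a b, (F t - c) * deriv χ t = - ∫ t in Set.Ioo a b, f t * χ t := by
      rw [← h1, ← sub_zero (∫ t in Set.Ioo a b, (∫ s in a..t, f s) * deriv χ t),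
        ← mul_zero c, ← h2, ← integral_const_mul,
        ← integral_sub (ic hFi hT.deriv.1.continuous) (hdi.const_mul c)]
      congr 1; ext t; ring
    have e : ∀ t ∈ Set.Ioo a b, (F t - c) * (t ^ n)⁻¹ * deriv φ t =
        (F t - c) * deriv χ t + (F t - c) * (n * (t ^ (n+1))⁻¹) * φ t := by
      intro t ht
      have ht0 : 0 < t := ha.trans ht.1
      have hd : HasDerivAt χ (-(n * t ^ (n - 1)) / (t ^ n) ^ 2 * φ t + (t ^ n)⁻¹ * deriv φ t) t :=
        ((hasDerivAt_pow n t).fun_inv (by positivity)).mul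
          ((hφ.1.differentiable (by simp)) t).hasDerivAt
      rw [hd.deriv]
      have : (n : ℝ) * t ^ (n - 1) / (t ^ n) ^ 2 = n * (t ^ (n+1))⁻¹ := by
        rcases n with _ | k
        · simp
        · simp only [Nat.add_sub_cancel]
          field_simp
          ring
      rw [neg_div, this]; ring
    rw [setIntegral_congr_fun measurableSet_Ioo e, integral_add (ic hFci hT.deriv.1.continuous)
      (ic i2 hφ.1.continuous), h3, eq_neg_iff_add_eq_zero, add_assoc,
      ← integral_add (ic i2 hφ.1.continuous) (ic i4 hφ.1.continuous),
      neg_add_eq_zero]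
    congr 1; ext t
    simp only [hχ]; ring

lemma ContDiff.dirDeriv {N : ℕ} {f : E N → ℝ} (hf : ContDiff ℝ (⊤ : ℕ∞) f) (v : E N) :
    ContDiff ℝ (⊤ : ℕ∞) (fun y => fderiv ℝ f y v) :=
  (hf.fderiv_right (m := ((⊤ : ℕ∞) : WithTop ℕ∞)) (by simp)).clm_apply contDiff_const

lemma HasCompactSupport.dirDeriv {N : ℕ} {f : E N → ℝ} (hf : HasCompactSupport f) (v : E N) :
    HasCompactSupport (fun y => fderiv ℝ f y v) := hf.fderiv_apply (𝕜 := ℝ) v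

lemma lapl_cont {N : ℕ} {f : E N → ℝ} (hf : ContDiff ℝ (⊤ : ℕ∞) f) : Continuous (lapl f) := by
  unfold lapl
  exact continuous_finsetSum _ fun i _ => ((hf.dirDeriv _).dirDeriv _).continuous

lemma lapl_cs {N : ℕ} {f : E N → ℝ} (hf : HasCompactSupport f) : HasCompactSupport (lapl f) := by
  refine HasCompactSupport.of_support_subset_isCompact (K := tsupport f) hf ?_
  intro x hx
  by_contra hn
  apply hx
  unfold lapl
  apply Finset.sum_eq_zero
  intro i _
  have h0 : f =ᶠ[𝓝 x] fun _ => 0 := notMem_tsupport_iff_eventuallyEq.1 hn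
  have h1 : (fun y => fderiv ℝ f y (EuclideanSpace.single i 1)) =ᶠ[𝓝 x] fun _ => 0 := by
    filter_upwards [h0.fderiv (𝕜 := ℝ)] with y hy
    simp [hy]
  rw [h1.fderiv_eq]; simp

lemma green1 {N : ℕ} {f g : E N → ℝ} (hf : ContDiff ℝ (⊤ : ℕ∞) f) (hg : ContDiff ℝ (⊤ : ℕ∞) g)
    (hcf : HasCompactSupport f) (hcg : HasCompactSupport g) (v : E N) :
    ∫ x, f x * fderiv ℝ g x v = - ∫ x, fderiv ℝ f x v * g x := by
  apply integral_mul_fderiv_eq_neg_fderiv_mul_of_integrable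
  · exact ((hf.dirDeriv v).continuous.mul hg.continuous).integrable_of_hasCompactSupport
      hcg.mul_left
  · exact (hf.continuous.mul (hg.dirDeriv v).continuous).integrable_of_hasCompactSupport
      hcf.mul_right
  · exact (hf.continuous.mul hg.continuous).integrable_of_hasCompactSupport
      hcf.mul_right
  · exact fun x _ => hf.differentiable (by simp) x
  · exact fun x _ => hg.differentiable (by simp) x

lemma green {N : ℕ} {f g : E N → ℝ} (hf : ContDiff ℝ (⊤ : ℕ∞) f) (hg : ContDiff ℝ (⊤ : ℕ∞) g)
    (hcf : HasCompactSupport f) (hcg : HasCompactSupport g) :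
    ∫ x, f x * lapl g x = ∫ x, lapl f x * g x := by
  unfold lapl
  simp only [Finset.mul_sum, Finset.sum_mul]
  rw [integral_finsetSum, integral_finsetSum]
  · apply Finset.sum_congr rfl
    intro i _
    rw [green1 hf (hg.dirDeriv _) hcf (hcg.dirDeriv _),
      green1 (hf.dirDeriv _) hg (hcf.dirDeriv _) hcg, neg_neg]
  · intro i _
    exact (((hf.dirDeriv _).dirDeriv _).continuous.mul
      hg.continuous).integrable_of_hasCompactSupport hcg.mul_left
  · intro i _
    exact (hf.continuous.mul
      ((hg.dirDeriv _).dirDeriv _).continuous).integrable_of_hasCompactSupport hcf.mul_right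

lemma limit_lem {N : ℕ} {p : ℝ≥0∞} (hp : 1 ≤ p) {f : ℕ → E N → ℝ} {u G : E N → ℝ}
    (hf : ∀ n, Continuous (f n)) (hu : MemLp u p volume)
    (h : Tendsto (fun n => eLpNorm (fun x => f n x - u x) p volume) atTop (𝓝 0))
    (hG : Continuous G) (hcG : HasCompactSupport G) :
    Tendsto (fun n => ∫ x, f n x * G x) atTop (𝓝 (∫ x, u x * G x)) := by
  have hH : p.HolderConjugate (ENNReal.conjExponent p) := .conjExponent hp
  have hH' : ENNReal.HolderTriple p (ENNReal.conjExponent p) 1 := hH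
  have hGq : MemLp G (ENNReal.conjExponent p) (volume : Measure (E N)) :=
    hG.memLp_of_hasCompactSupport hcG
  apply tendsto_integral_of_L1'
  · exact hu.1.mul hG.aestronglyMeasurable
  · exact Eventually.of_forall fun n =>
      ((hf n).mul hG).integrable_of_hasCompactSupport hcG.mul_left
  · have h2 := ENNReal.Tendsto.mul_const (b := eLpNorm G (ENNReal.conjExponent p) volume) h
      (Or.inr hGq.2.ne)
    rw [zero_mul] at h2
    refine tendsto_of_tendsto_of_tendsto_of_le_of_le tendsto_const_nhds h2 (fun _ => zero_le) ?_
    intro n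
    have := eLpNorm_smul_le_mul_eLpNorm (p := p) (q := ENNReal.conjExponent p) (r := 1)
      hGq.1 (φ := fun x => f n x - u x) ((hf n).aestronglyMeasurable.sub hu.1)
    have e : ((fun x => f n x * G x) - fun x => u x * G x) = (fun x => f n x - u x) • G := by
      ext x
      simp only [Pi.sub_apply, Pi.smul_apply', smul_eq_mul]; ring
    rw [← e] at this
    exact this

lemma Tst.norm_zero {N : ℕ} {a b : ℝ} (ha : 0 < a) {ρ : ℝ → ℝ} (h : Tst a b ρ) :
    (fun x : E N => ρ ‖x‖) =ᶠ[𝓝 0] fun _ => 0 := by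
  filter_upwards [Metric.ball_mem_nhds (0 : E N) ha] with x hx
  apply h.zero_of
  rw [mem_ball_zero_iff] at hx
  exact fun hh => absurd hh.1 (by linarith)

lemma Tst.norm_contDiff {N : ℕ} {a b : ℝ} (ha : 0 < a) {ρ : ℝ → ℝ} (h : Tst a b ρ) :
    ContDiff ℝ (⊤ : ℕ∞) (fun x : E N => ρ ‖x‖) := by
  rw [contDiff_iff_contDiffAt]
  intro x
  rcases eq_or_ne x 0 with rfl | hx
  · exact contDiffAt_const.congr_of_eventuallyEq (h.norm_zero ha)
  · exact h.1.contDiffAt.comp x (contDiffAt_norm ℝ hx)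

lemma Tst.norm_cs {N : ℕ} {a b : ℝ} {ρ : ℝ → ℝ} (h : Tst a b ρ) :
    HasCompactSupport (fun x : E N => ρ ‖x‖) := by
  refine HasCompactSupport.of_support_subset_isCompact (isCompact_closedBall (0 : E N) b) ?_
  intro x hx
  by_contra hn
  apply hx
  apply h.zero_of
  rw [mem_closedBall_zero_iff, not_le] at hn
  exact fun hh => absurd hh.2 (by linarith)

lemma Tst.norm_fderiv {N : ℕ} {a b : ℝ} (ha : 0 < a) {ρ : ℝ → ℝ} (h : Tst a b ρ) (x : E N) :
    HasFDerivAt (fun x : E N => ρ ‖x‖) ((‖x‖⁻¹ * _root_.deriv ρ ‖x‖) • innerSL ℝ x) x := by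
  rcases eq_or_ne x 0 with rfl | hx
  · have : HasFDerivAt (fun _ : E N => (0:ℝ)) (0 : E N →L[ℝ] ℝ) 0 := hasFDerivAt_const _ _
    convert! this.congr_of_eventuallyEq (h.norm_zero ha) using 1
    simp
  · have hx' : ‖x‖ ≠ 0 := norm_ne_zero_iff.2 hx
    have h1 : HasDerivAt ρ (_root_.deriv ρ ‖x‖) ‖x‖ := (h.1.differentiable (by simp) _).hasDerivAt
    have h2 : HasFDerivAt (fun y : E N => ‖y‖ ^ 2) (2 • innerSL ℝ x) x :=
      (hasStrictFDerivAt_norm_sq x).hasFDerivAt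
    have h3 := h2.sqrt (by positivity)
    simp only [Real.sqrt_sq (norm_nonneg _)] at h3
    have h4 := h1.comp_hasFDerivAt x h3
    convert! h4 using 1
    ext y
    simp
    field_simp

lemma lapl_radial {N : ℕ} {a b : ℝ} (ha : 0 < a) {ψ : ℝ → ℝ} (h : Tst a b ψ) (x : E N) :
    lapl (fun x : E N => ψ ‖x‖) x =
      ‖x‖ * deriv (fun r => r⁻¹ * deriv ψ r) ‖x‖ + N * (‖x‖⁻¹ * deriv ψ ‖x‖) := by
  set κ : ℝ → ℝ := fun r => r⁻¹ * deriv ψ r with hκ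
  have hT : Tst a b κ := h.deriv.mul ha (fun x hx => contDiffAt_id.inv hx.ne')
  have e1 : ∀ i : Fin N, (fun y : E N => fderiv ℝ (fun x : E N => ψ ‖x‖) y
      (EuclideanSpace.single i 1)) = fun y => κ ‖y‖ * y i := by
    intro i; ext y
    rw [(h.norm_fderiv ha y).fderiv]
    simp [hκ, EuclideanSpace.inner_single_right]
  unfold lapl
  have e2 : ∀ i : Fin N, fderiv ℝ (fun y : E N => κ ‖y‖ * y i) x (EuclideanSpace.single i 1)
      = κ ‖x‖ + (‖x‖⁻¹ * deriv κ ‖x‖) * (x i) ^ 2 := by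
    intro i
    have hp : HasFDerivAt (fun y : E N => y i) (EuclideanSpace.proj i : E N →L[ℝ] ℝ) x :=
      (EuclideanSpace.proj i : E N →L[ℝ] ℝ).hasFDerivAt
    have := (hT.norm_fderiv ha x).fun_mul hp
    rw [this.fderiv]
    simp [EuclideanSpace.inner_single_right]
    ring
  simp only [e1, e2]
  rw [Finset.sum_add_distrib, ← Finset.mul_sum (f := fun i => x i ^ 2), ← EuclideanSpace.real_norm_sq_eq]
  simp only [Finset.sum_const, Finset.card_univ, Fintype.card_fin, nsmul_eq_mul]
  rcases eq_or_ne ‖x‖ 0 with h0 | h0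
  · simp [h0, hκ]
  · have hk : ‖x‖⁻¹ * deriv ψ ‖x‖ = κ ‖x‖ := rfl
    rw [hk]
    field_simp
    ring

/-- the sigma-algebra generated by the norm -/
@[reducible] noncomputable def normAlg (N : ℕ) : MeasurableSpace (E N) :=
  MeasurableSpace.comap (fun x : E N => ‖x‖) inferInstance

lemma exists_avg {N : ℕ} {b : ℝ} {w : E N → ℝ} (hw : MemLp w 2 volume) :
    ∃ A : ℝ → ℝ, IntegrableOn (fun x : E N => A ‖x‖) (Metric.ball 0 b) ∧
      ∀ a ψ, Tst a b ψ → 0 < a → ∫ x, w x * ψ ‖x‖ = ∫ x : E N, A ‖x‖ * ψ ‖x‖ := by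
  set μ : Measure (E N) := volume.restrict (Metric.ball 0 b) with hμ
  have : IsFiniteMeasure μ := ⟨by
    rw [hμ, Measure.restrict_apply_univ]; exact measure_ball_lt_top⟩
  have hwi : Integrable w μ := (hw.restrict _).integrable (by norm_num)
  have hle : normAlg N ≤ (inferInstance : MeasurableSpace (E N)) := measurable_norm.comap_le
  obtain ⟨A, hA, hAe⟩ := (stronglyMeasurable_condExp (f := w) (μ := μ) (m := normAlg N)).exists_eq_measurable_comp
  refine ⟨A, ?_, ?_⟩
  · have : Integrable (A ∘ fun x : E N => ‖x‖) μ := by rw [← hAe]; exact integrable_condExp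
    exact this
  · intro a ψ hψ ha
    have hz : ∀ x : E N, x ∉ Metric.ball (0 : E N) b → ψ ‖x‖ = 0 := by
      intro x hx
      apply hψ.zero_of
      rw [mem_ball_zero_iff] at hx
      exact fun hh => hx hh.2
    rw [← setIntegral_eq_integral_of_forall_compl_eq_zero (s := Metric.ball (0 : E N) b)
        (fun x hx => by rw [hz x hx, mul_zero]),
      ← setIntegral_eq_integral_of_forall_compl_eq_zero (s := Metric.ball (0 : E N) b)
        (f := fun x => A ‖x‖ * ψ ‖x‖) (fun x hx => by rw [hz x hx, mul_zero])]
    have hg : StronglyMeasurable[normAlg N] (fun x : E N => ψ ‖x‖) :=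
      (hψ.1.continuous.measurable.comp (comap_measurable _)).stronglyMeasurable
    have hgc : Continuous (fun x : E N => ψ ‖x‖) := hψ.1.continuous.comp continuous_norm
    have hwg : Integrable (w * fun x : E N => ψ ‖x‖) μ := by
      obtain ⟨C, hC⟩ := hgc.bounded_above_of_compact_support hψ.norm_cs
      exact hwi.mul_bdd hgc.aestronglyMeasurable (c := C) (Eventually.of_forall hC)
    have h1 := condExp_mul_of_stronglyMeasurable_right hg hwg hwi
    have h2 := integral_condExp (μ := μ) (f := w * fun x : E N => ψ ‖x‖) hle
    rw [integral_congr_ae h1, hAe] at h2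
    exact h2.symm

lemma one_le_twoSS {N : ℕ} (hN : 5 ≤ N) : 1 ≤ twoSS N := by
  unfold twoSS
  rw [ENNReal.le_div_iff_mul_le, one_mul]
  · calc (N : ℝ≥0∞) - 4 ≤ N := tsub_le_self
      _ ≤ 2 * N := le_mul_of_one_le_left' (by norm_num)
  · left
    rw [Ne, tsub_eq_zero_iff_le, not_le]
    exact_mod_cast (by omega : 4 < N)
  · left
    exact (tsub_le_self.trans_lt (ENNReal.natCast_lt_top N)).ne

/-- Lemma 5.1: if `u ∈ D^{2,2}_r(ℝ^N)` and `ũ : (0,∞) → ℝ` is such that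
`u(x) = ũ(|x|)` a.e., then `ũ ∈ W^{2,1}(I)` for every open bounded interval
`I = (a,b) ⊂ (0,∞)` with `inf I > 0`: `ũ` is integrable on `I` and has weak derivatives
of first and second order which are integrable on `I`. -/
theorem stmt13 (N : ℕ) (hN : 5 ≤ N) (u w : E N → ℝ) (hu : MemD22 N u w)
    (hrad : IsRadial u) (ut : ℝ → ℝ) (hut : ∀ᵐ x : E N ∂volume, u x = ut ‖x‖) :
    ∀ a b : ℝ, 0 < a → a < b →
      IntegrableOn ut (Set.Ioo a b) volume ∧
      ∃ g h : ℝ → ℝ,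
        IntegrableOn g (Set.Ioo a b) volume ∧ IntegrableOn h (Set.Ioo a b) volume ∧
        (∀ φ : ℝ → ℝ, ContDiff ℝ (⊤ : ℕ∞) φ → HasCompactSupport φ → tsupport φ ⊆ Set.Ioo a b →
          ∫ t in Set.Ioo a b, ut t * deriv φ t = - ∫ t in Set.Ioo a b, g t * φ t) ∧
        (∀ φ : ℝ → ℝ, ContDiff ℝ (⊤ : ℕ∞) φ → HasCompactSupport φ → tsupport φ ⊆ Set.Ioo a b →
          ∫ t in Set.Ioo a b, g t * deriv φ t = - ∫ t in Set.Ioo a b, h t * φ t) := by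
  intro a b ha hab
  obtain ⟨hu1, hw, φ, hφ, hφu, hφw⟩ := hu
  obtain ⟨n, rfl⟩ : ∃ n, N = n + 1 := ⟨N - 1, by omega⟩
  have hp := one_le_twoSS hN
  have hfin : Module.finrank ℝ (E (n+1)) - 1 = n := by simp
  have hne : ∀ x ∈ Set.Icc a b, x ^ n ≠ 0 := fun x hx => (pow_pos (ha.trans_le hx.1) n).ne'
  have hic : ContinuousOn (fun x : ℝ => (x ^ n)⁻¹) (Set.Icc a b) :=
    (continuous_pow n).continuousOn.inv₀ hne
  have hU : IntegrableOn ut (Set.Ioo a b) volume := by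
    have h1 : IntegrableOn u (Metric.ball 0 b) := by
      have : IsFiniteMeasure ((volume : Measure (E (n+1))).restrict (Metric.ball 0 b)) :=
        ⟨by rw [Measure.restrict_apply_univ]; exact measure_ball_lt_top⟩
      exact (hu1.restrict _).integrable hp
    have h2 : IntegrableOn (fun x : E (n+1) => ut ‖x‖) (Metric.ball 0 b) :=
      h1.congr (ae_restrict_of_ae hut)
    rw [integrableOn_fun_norm_addHaar, hfin] at h2
    have h3 := integrableOn_mul_cont (h2.mono_set (Ioo_subset_Ioo_left ha.le)) hic
    refine h3.congr_fun (fun t ht => ?_) measurableSet_Ioo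
    have := hne t (Ioo_subset_Icc_self ht)
    simp only [smul_eq_mul]
    field_simp
  refine ⟨hU, ?_⟩
  obtain ⟨A, hA, hAw⟩ := exists_avg (b := b) hw
  have hf : IntegrableOn (fun t => t ^ n * A t) (Set.Ioo a b) := by
    rw [integrableOn_fun_norm_addHaar, hfin] at hA
    exact hA.mono_set (Ioo_subset_Ioo_left ha.le)
  have polar : ∀ v : ℝ → ℝ, (∀ t, t ∉ Set.Ioo a b → v t = 0) →
      ∫ x : E (n+1), v ‖x‖ = ((n+1 : ℕ) : ℝ) * (volume.real (Metric.ball (0 : E (n+1)) 1) *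
        ∫ t in Set.Ioo a b, t ^ n * v t) := by
    intro v hv
    rw [integral_fun_norm_addHaar, hfin]
    simp only [finrank_euclideanSpace, Fintype.card_fin, nsmul_eq_mul, smul_eq_mul]
    congr 2
    exact (setIntegral_eq_of_subset_of_forall_sdiff_eq_zero measurableSet_Ioi
      (s := Set.Ioo a b) (f := fun t => t ^ n * v t) (fun x hx => ha.trans hx.1) (fun x hx => by rw [hv x hx.2, mul_zero]))
  have hC : volume.real (Metric.ball (0 : E (n+1)) 1) ≠ 0 :=
    (ENNReal.toReal_pos (Metric.measure_ball_pos volume _ one_pos).ne' measure_ball_lt_top.ne).ne'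
  have H : ∀ ψ, Tst a b ψ → ∫ t in Set.Ioo a b, ut t * deriv (fun r => r ^ n * deriv ψ r) t
      = ∫ t in Set.Ioo a b, (t ^ n * A t) * ψ t := by
    intro ψ hψ
    have hΨ := hψ.norm_contDiff (N := n+1) ha
    have hΨc := hψ.norm_cs (N := n+1)
    have l1 := limit_lem hp (fun k => (hφ k).1.continuous) hu1 hφu (lapl_cont hΨ) (lapl_cs hΨc)
    have l2 := limit_lem (by norm_num) (fun k => lapl_cont (hφ k).1) hw hφw hΨ.continuous hΨc
    simp only [fun k => green (hφ k).1 hΨ (hφ k).2 hΨc] at l1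
    have key := tendsto_nhds_unique l1 l2
    rw [hAw a ψ hψ ha] at key
    set κ : ℝ → ℝ := fun r => r⁻¹ * deriv ψ r with hκ
    have hT : Tst a b κ := hψ.deriv.mul ha (fun x hx => contDiffAt_id.inv hx.ne')
    have e1 : ∫ x, u x * lapl (fun x : E (n+1) => ψ ‖x‖) x =
        ∫ x : E (n+1), ut ‖x‖ * (‖x‖ * deriv κ ‖x‖ + ((n+1 : ℕ) : ℝ) * κ ‖x‖) := by
      apply integral_congr_ae
      filter_upwards [hut] with x hx
      rw [lapl_radial ha hψ, hx]
    rw [e1, polar (fun t => ut t * (t * deriv κ t + ((n+1 : ℕ) : ℝ) * κ t)) (fun t ht => by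
        simp [hT.zero_of ht, hT.deriv.zero_of ht]),
      polar (fun t => A t * ψ t) (fun t ht => by simp [hψ.zero_of ht])] at key
    have key2 := mul_left_cancel₀ hC (mul_left_cancel₀ (by positivity) key)
    have e2 : (fun r => r ^ n * deriv ψ r) = fun r => r ^ (n+1) * κ r := by
      ext r
      by_cases hr : r ∈ Set.Ioo a b
      · have : r ≠ 0 := (ha.trans hr.1).ne'
        simp only [hκ]; field_simp; ring
      · simp [hψ.deriv.zero_of hr, hκ]
    have e3 : ∀ t, deriv (fun r => r ^ n * deriv ψ r) t =
        t ^ n * (t * deriv κ t + ((n+1 : ℕ) : ℝ) * κ t) := by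
      intro t
      rw [e2]
      have := (hasDerivAt_pow (n+1) t).mul (hT.1.differentiable (by simp) t).hasDerivAt
      refine this.deriv.trans ?_
      simp only [Nat.add_sub_cancel]; ring
    calc _ = ∫ t in Set.Ioo a b, t ^ n * (ut t * (t * deriv κ t + ((n+1 : ℕ) : ℝ) * κ t)) := by
          congr 1; ext t; rw [e3]; ring
      _ = _ := by rw [key2]; congr 1; ext t; ring
  obtain ⟨g, h, hg, hh, h1, h2⟩ := oneD ha hab n hU hf H
  exact ⟨g, h, hg, hh, fun φ p q r => h1 φ ⟨p, q, r⟩, fun φ p q r => h2 φ ⟨p, q, r⟩⟩
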